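/- Let n ≥ 2, let B = closedBall(x₀, R) ⊂ ℝⁿ be a closed ball with R > 0, and let (v₀, p₀, R̊₀) be maps defined on B × ℝ, with v₀ taking values in ℝⁿ, p₀ in ℝ, and R̊₀ in the symmetric trace-free n×n matrices, which are infinitely differentiable on the set B × ℝ (in the sense of ContDiffOn, i.e., smooth up to the boundary) and satisfy ∂_t v₀ + v₀·∇v₀ + ∇p₀ = Div R̊₀ and div v₀ = 0 on the open ball ball(x₀, R) × ℝ. Then there exists a smooth subsolution (v, p, R̊) of the Euler equations on all of ℝⁿ × ℝ with (v, p, R̊)(x,t) = (v₀, p₀, R̊₀)(x,t) for all x ∈ B and all t ∈ ℝ. -/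

import Mathlib

noncomputable section
open MeasureTheory

/-- `Euc n` is Euclidean space `ℝⁿ`. -/
abbrev Euc (n : ℕ) := EuclideanSpace ℝ (Fin n)

/-- Spatial partial derivative `∂ⱼ` of a scalar function of space and time. -/
def spd {n : ℕ} (j : Fin n) (f : Euc n × ℝ → ℝ) (q : Euc n × ℝ) : ℝ :=
  fderiv ℝ (fun y => f (y, q.2)) q.1 (EuclideanSpace.single j 1)

/-- Temporal partial derivative `∂ₜ` of a scalar function of space and time. -/
def tpd {n : ℕ} (f : Euc n × ℝ → ℝ) (q : Euc n × ℝ) : ℝ :=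
  deriv (fun s => f (q.1, s)) q.2

/-- `(v, p, R̊)` is a smooth subsolution of the Euler equations on `V`:
`v, p, R̊` are smooth on `V`, `R̊` is symmetric and trace-free, and
`∂ₜ v + v·∇v + ∇p = Div R̊`, `div v = 0` hold on `V`. -/
def IsSubsolutionOn {n : ℕ} (V : Set (Euc n × ℝ)) (v : Euc n × ℝ → Fin n → ℝ)
    (p : Euc n × ℝ → ℝ) (R : Euc n × ℝ → Fin n → Fin n → ℝ) : Prop :=
  ContDiffOn ℝ (⊤ : ℕ∞) v V ∧ ContDiffOn ℝ (⊤ : ℕ∞) p V ∧ ContDiffOn ℝ (⊤ : ℕ∞) R V ∧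
  (∀ q ∈ V, ∀ i j, R q i j = R q j i) ∧
  (∀ q ∈ V, ∑ i, R q i i = 0) ∧
  (∀ q ∈ V, ∀ i, tpd (fun y => v y i) q
      + (∑ j, v q j * spd j (fun y => v y i) q) + spd i p q
      = ∑ j, spd j (fun y => R y i j) q) ∧
  (∀ q ∈ V, ∑ i, spd i (fun y => v y i) q = 0)


open Set Filter Topology

def sA (k : ℤ) : ℝ := (-1 : ℝ)^k * (3:ℝ)^(-(k*(k-1)))
def sB (k : ℤ) : ℝ := (3:ℝ)^(2*k)

lemma sB_pos (k : ℤ) : 0 < sB k := by unfold sB; positivity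

lemma hasSum_pow_natAbs (r : ℝ) (h0 : 0 ≤ r) (h1 : r < 1) :
    HasSum (fun k : ℤ => r ^ k.natAbs) ((1 - r)⁻¹ + r * (1 - r)⁻¹) := by
  apply HasSum.of_nat_of_neg_add_one
  · simpa using hasSum_geometric_of_lt_one h0 h1
  · have := (hasSum_geometric_of_lt_one h0 h1).mul_left r
    have e : (fun k : ℕ => r ^ (-((k:ℤ) + 1)).natAbs) = fun i => r * r ^ i := by
      funext k
      rw [← pow_succ']
      congr 1
    rw [e]
    exact this

lemma sA_abs (k : ℤ) : |sA k| = (3:ℝ)^(-(k*(k-1))) := by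
  unfold sA
  rw [abs_mul, abs_zpow]
  simp [abs_of_pos (show (0:ℝ) < 3 ^ (k*(k-1)) by positivity)]

lemma sAB (k : ℤ) (m : ℕ) : |sA k| * sB k ^ m = (3:ℝ)^(-k*k+(2*m+1)*k) := by
  rw [sA_abs, sB, ← zpow_natCast, ← zpow_mul, ← zpow_add₀ (by norm_num)]
  congr 1; ring

lemma sAB_summable (m : ℕ) : Summable (fun k => |sA k| * sB k ^ m) := by
  have h := (hasSum_pow_natAbs (1/3) (by norm_num) (by norm_num)).summable.mul_left ((3:ℝ)^(((m:ℤ)+1)^2))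
  refine Summable.of_nonneg_of_le (fun k => ?_) (fun k => ?_) h
  · have := sB_pos k; positivity
  · rw [sAB]
    have : (1/3:ℝ)^k.natAbs = (3:ℝ)^(-(|k|)) := by
      rw [← Int.natCast_natAbs, zpow_neg, zpow_natCast]; simp
    rw [this, ← zpow_add₀ (by norm_num)]
    apply zpow_le_zpow_right₀ (by norm_num)
    rcases abs_cases k with ⟨h, h'⟩ | ⟨h, h'⟩ <;> rw [h]
    · nlinarith [sq_nonneg (k - (m+1))]
    · have : 0 ≤ (m:ℤ) := by positivity
      nlinarith [mul_nonneg this (neg_nonneg.2 h'.le), sq_nonneg (m + 1 : ℤ)]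

lemma sAB_summable' (m : ℕ) : Summable (fun k => sA k * sB k ^ m) := by
  apply Summable.of_abs
  simpa [abs_mul, abs_of_pos (sB_pos _)] using sAB_summable m

lemma sAB_tsum (m : ℕ) : ∑' k, sA k * sB k ^ m = 0 := by
  have h1 := (Equiv.subLeft (2*(m:ℤ)+1)).tsum_eq (fun k => sA k * sB k ^ m)
  have h2 : ∀ k, sA (Equiv.subLeft (2*(m:ℤ)+1) k) * sB (Equiv.subLeft (2*(m:ℤ)+1) k) ^ m
      = - (sA k * sB k ^ m) := by
    intro k
    have e : ∀ k, sA k * sB k ^ m = (-1:ℝ)^k * (3:ℝ)^(-k*k+(2*m+1)*k) := by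
      intro k
      unfold sA sB
      rw [mul_assoc, ← zpow_natCast ((3:ℝ)^(2*k)), ← zpow_mul, ← zpow_add₀ (by norm_num)]
      congr 2; ring
    rw [e, e]
    simp only [Equiv.subLeft_apply]
    have : (-1:ℝ)^(2*(m:ℤ)+1-k) = - (-1:ℝ)^k := by
      rw [zpow_sub₀ (by norm_num), zpow_add₀ (by norm_num), zpow_mul]
      simp
      rw [div_eq_mul_inv, ← inv_zpow]; norm_num
    rw [this, neg_mul]
    congr 3; ring
  simp_rw [h2, tsum_neg] at h1
  linarith

lemma sC_bound (k : ℤ) : |sA k / (1 + sB k)| ≤ (1/9:ℝ)^k.natAbs := by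
  have hB := sB_pos k
  rw [abs_div, abs_of_pos (by positivity : 0 < 1 + sB k), div_le_iff₀ (by positivity), sA_abs]
  have : (1/9:ℝ)^k.natAbs = (3:ℝ)^(-(2*|k|)) := by
    rw [← Int.natCast_natAbs, zpow_neg, zpow_mul, zpow_natCast, one_div, inv_pow]; norm_num
  rw [this]
  rcases abs_cases k with ⟨h, h'⟩ | ⟨h, h'⟩ <;> rw [h]
  · calc (3:ℝ)^(-(k*(k-1))) ≤ (3:ℝ)^(-(2*k)) * sB k := by
          rw [sB, ← zpow_add₀ (by norm_num)]
          apply zpow_le_zpow_right₀ (by norm_num)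
          rcases h'.eq_or_lt with rfl | h''
          · simp
          · nlinarith
      _ ≤ _ := by gcongr; linarith
  · calc (3:ℝ)^(-(k*(k-1))) ≤ (3:ℝ)^(-(2*-k)) * 1 := by
          rw [mul_one]
          apply zpow_le_zpow_right₀ (by norm_num)
          nlinarith
      _ ≤ _ := by gcongr; linarith

def sC0 : ℝ := ∑' k, sA k / (1 + sB k)

lemma sC0_summable : Summable (fun k => sA k / (1 + sB k)) :=
  Summable.of_norm_bounded (hasSum_pow_natAbs (1/9) (by norm_num) (by norm_num)).summable
    (fun k => sC_bound k)

lemma sC0_pos : 0 < sC0 := by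
  have h1 := sC0_summable.hasSum
  have h2 := hasSum_pow_natAbs (1/9) (by norm_num) (by norm_num)
  have h3 := h1.sub (hasSum_ite_eq (0:ℤ) (1/2:ℝ))
  have h4 := h2.sub (hasSum_ite_eq (0:ℤ) (1:ℝ))
  have h5 := hasSum_le (fun k => ?_) h3.neg h4
  · change -(sC0 - 1/2) ≤ _ at h5
    norm_num at h5; linarith
  · by_cases hk : k = 0
    · subst hk; simp [sA, sB]; norm_num
    · simp only [hk, if_false, sub_zero]
      exact (neg_le_abs _).trans (sC_bound k)

def sC (k : ℤ) : ℝ := sA k / (1 + sB k) / sC0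

lemma sC_summable (m : ℕ) : Summable (fun k => |sC k| * sB k ^ m) := by
  refine Summable.of_nonneg_of_le (fun k => ?_) (fun k => ?_) ((sAB_summable m).mul_left (1/sC0))
  · have := sB_pos k; positivity
  · have := sB_pos k
    have h := sC0_pos
    rw [sC, abs_div, abs_div, abs_of_pos h, abs_of_pos (by positivity : 0 < 1 + sB k), ← mul_assoc]
    gcongr
    rw [div_mul_eq_mul_div, one_mul]
    gcongr
    exact div_le_self (abs_nonneg _) (by linarith)

lemma sC_summable' (m : ℕ) : Summable (fun k => sC k * (-sB k) ^ m) := by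
  apply Summable.of_abs
  simpa [abs_mul, abs_of_pos (sB_pos _)] using sC_summable m

lemma sC_tsum (m : ℕ) : ∑' k, sC k * (-sB k) ^ m = 1 := by
  induction m with
  | zero =>
    simp only [pow_zero, mul_one, sC, tsum_div_const]
    exact div_self sC0_pos.ne'
  | succ m ih =>
    have : ∀ k, sC k * (-sB k)^(m+1) = sC k * (-sB k)^m - ((-1)^m / sC0) * (sA k * sB k ^ m) := by
      intro k
      have := sB_pos k
      have h := sC0_pos
      rw [neg_pow (sB k), neg_pow (sB k), sC]
      field_simp
      ring
    simp_rw [this]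
    rw [Summable.tsum_sub (sC_summable' m) ((sAB_summable' m).mul_left _), ih, tsum_mul_left, sAB_tsum]
    simp

section halfspace
set_option linter.unusedSectionVars false
variable {X : Type} [NormedAddCommGroup X] [NormedSpace ℝ X] [ProperSpace X]
  {F : Type} [NormedAddCommGroup F] [NormedSpace ℝ F] [CompleteSpace F]

def sE (l : ℕ) (g : X × ℝ → F) (q : X × ℝ) : F :=
  if q.2 ≤ 0 then g q else ∑' k, (sC k * (-sB k)^l) • g (q.1, -sB k * q.2)

lemma loc_bound {U : Set X} (hU : IsOpen U) {g : X × ℝ → F}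
    (hg : ContinuousOn g (U ×ˢ Iic (0:ℝ))) (h0 : ∀ q : X × ℝ, q.2 < -1 → g q = 0)
    {x : X} (hx : x ∈ U) :
    ∃ r > 0, Metric.ball x r ⊆ U ∧ ∃ M, ∀ y ∈ Metric.ball x r, ∀ s ≤ (0:ℝ), ‖g (y, s)‖ ≤ M := by
  obtain ⟨r, hr, hrU⟩ := Metric.nhds_basis_closedBall.mem_iff.1 (hU.mem_nhds hx)
  have hK : IsCompact (Metric.closedBall x r ×ˢ Icc (-1:ℝ) 0) :=
    (isCompact_closedBall x r).prod isCompact_Icc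
  obtain ⟨M, hM⟩ := hK.exists_bound_of_continuousOn
    (hg.mono (prod_mono hrU Icc_subset_Iic_self))
  refine ⟨r, hr, Metric.ball_subset_closedBall.trans hrU, max M 0, fun y hy s hs => ?_⟩
  by_cases h : s < -1
  · rw [h0 _ h]; simp
  · exact (hM _ ⟨Metric.ball_subset_closedBall hy, not_lt.1 h, hs⟩).trans (le_max_left _ _)

lemma term_bound {g : X × ℝ → F} {l : ℕ} {V : Set X} {M : ℝ}
    (hM : ∀ y ∈ V, ∀ s ≤ (0:ℝ), ‖g (y, s)‖ ≤ M) (k : ℤ) (q : X × ℝ) (hq : q ∈ V ×ˢ Ici (0:ℝ)) :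
    ‖(sC k * (-sB k)^l) • g (q.1, -sB k * q.2)‖ ≤ |sC k| * sB k ^ l * M := by
  have := sB_pos k
  rw [norm_smul, norm_mul, norm_pow, norm_neg, Real.norm_eq_abs, Real.norm_eq_abs, abs_of_pos this]
  gcongr
  apply hM _ hq.1
  have := hq.2
  simp only [mem_Ici] at this
  nlinarith

lemma series_cont {U : Set X} {g : X × ℝ → F}
    (hg : ContinuousOn g (U ×ˢ Iic (0:ℝ))) {l : ℕ} {V : Set X} (hVU : V ⊆ U) {M : ℝ}
    (hM : ∀ y ∈ V, ∀ s ≤ (0:ℝ), ‖g (y, s)‖ ≤ M) :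
    ContinuousOn (fun q : X × ℝ => ∑' k, (sC k * (-sB k)^l) • g (q.1, -sB k * q.2))
      (V ×ˢ Ici (0:ℝ)) := by
  refine continuousOn_tsum (fun k => ?_) ((sC_summable l).mul_right M) (term_bound hM)
  refine ContinuousOn.const_smul ?_ _
  refine hg.comp (by fun_prop) ?_
  rintro ⟨y, s⟩ ⟨hy, hs⟩
  refine ⟨hVU hy, ?_⟩
  have := sB_pos k
  simp only [mem_Ici, mem_Iic] at *
  nlinarith

lemma sE_cont {U : Set X} (hU : IsOpen U) {g : X × ℝ → F}
    (hg : ContinuousOn g (U ×ˢ Iic (0:ℝ))) (h0 : ∀ q : X × ℝ, q.2 < -1 → g q = 0) (l : ℕ) :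
    ContinuousOn (sE l g) (U ×ˢ univ) := by
  rintro ⟨x, s⟩ ⟨hx, -⟩
  obtain ⟨r, hr, hrU, M, hM⟩ := loc_bound hU hg h0 hx
  have hc : ContinuousOn (sE l g) (Metric.ball x r ×ˢ univ) := by
    unfold sE
    apply ContinuousOn.if
    · rintro q ⟨hq, hf⟩
      have hq2 : q.2 = 0 := frontier_le_subset_eq continuous_snd continuous_const hf
      have : ∀ k : ℤ, g (q.1, -sB k * q.2) = g q := by
        intro k; congr 1; ext <;> simp [hq2]
      simp_rw [this]
      rw [(sC_summable' l).tsum_smul_const, sC_tsum, one_smul]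
    · refine hg.mono ?_
      rintro q ⟨hq, hf⟩
      rw [(isClosed_le continuous_snd continuous_const).closure_eq] at hf
      exact ⟨hrU hq.1, hf⟩
    · refine (series_cont hg hrU hM).mono ?_
      rintro q ⟨hq, hf⟩
      refine ⟨hq.1, ?_⟩
      have : closure {a : X × ℝ | ¬ a.2 ≤ 0} ⊆ {a : X × ℝ | 0 ≤ a.2} := by
        apply closure_minimal
        · intro a ha; simp at ha; exact ha.le
        · exact isClosed_le continuous_const continuous_snd
      exact this hf
  exact (hc.continuousAt ((Metric.isOpen_ball.prod isOpen_univ).mem_nhds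
    ⟨Metric.mem_ball_self hr, trivial⟩)).continuousWithinAt

lemma glue_deriv {U : Set X} (hU : IsOpen U) {f : X × ℝ → F} {f' : X × ℝ → (X × ℝ →L[ℝ] F)}
    (hf : ContinuousOn f (U ×ˢ univ)) (hf' : ContinuousOn f' (U ×ˢ univ))
    (hd : ∀ q : X × ℝ, q.1 ∈ U → q.2 ≠ 0 → HasFDerivAt f (f' q) q) (q : X × ℝ) (hq : q.1 ∈ U) :
    HasFDerivAt f (f' q) q := by
  by_cases h : q.2 ≠ 0
  · exact hd q hq h
  push Not at h
  obtain ⟨r, hr, hrU⟩ := Metric.nhds_basis_closedBall.mem_iff.1 (hU.mem_nhds hq)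
  have hWo : IsOpen (U ×ˢ (univ : Set ℝ)) := hU.prod isOpen_univ
  have key : ∀ I : Set ℝ, IsOpen I → Convex ℝ I → (∀ s ∈ I, s ≠ 0) →
      HasFDerivWithinAt f (f' q) (closure (Metric.ball q.1 r ×ˢ I)) q := by
    intro I hI hIc hI0
    have hsub : closure (Metric.ball q.1 r ×ˢ I) ⊆ U ×ˢ univ := by
      rw [closure_prod_eq]
      exact prod_mono (Metric.closure_ball_subset_closedBall.trans hrU) (subset_univ _)
    have hd' : ∀ y ∈ Metric.ball q.1 r ×ˢ I, HasFDerivAt f (f' y) y := fun y hy =>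
      hd y (hrU (Metric.ball_subset_closedBall hy.1)) (hI0 _ hy.2)
    apply hasFDerivWithinAt_closure_of_tendsto_fderiv
    · exact fun y hy => (hd' y hy).differentiableAt.differentiableWithinAt
    · exact (convex_ball _ _).prod hIc
    · exact Metric.isOpen_ball.prod hI
    · intro y hy
      exact (hf.continuousAt (hWo.mem_nhds (hsub hy))).continuousWithinAt
    · have : Tendsto f' (𝓝[Metric.ball q.1 r ×ˢ I] q) (𝓝 (f' q)) :=
        (hf'.continuousAt (hWo.mem_nhds ⟨hq, trivial⟩)).continuousWithinAt
      refine this.congr' ?_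
      filter_upwards [self_mem_nhdsWithin] with y hy
      exact (hd' y hy).fderiv.symm
  have h1 := key (Iio 0) isOpen_Iio (convex_Iio _) (fun s hs => ne_of_lt hs)
  have h2 := key (Ioi 0) isOpen_Ioi (convex_Ioi _) (fun s hs => ne_of_gt hs)
  refine (h1.union h2).hasFDerivAt ?_
  have : Metric.ball q.1 r ×ˢ univ ∈ 𝓝 q :=
    (Metric.isOpen_ball.prod isOpen_univ).mem_nhds ⟨Metric.mem_ball_self hr, trivial⟩
  refine mem_of_superset this ?_
  rintro y ⟨hy, -⟩
  rw [closure_prod_eq, closure_prod_eq, closure_Iio, closure_Ioi]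
  rcases le_total y.2 0 with h | h
  · exact Or.inl ⟨subset_closure hy, h⟩
  · exact Or.inr ⟨subset_closure hy, h⟩

variable (X) in
def prP : X × ℝ →L[ℝ] X × ℝ := (ContinuousLinearMap.inl ℝ X ℝ).comp (ContinuousLinearMap.fst ℝ X ℝ)
variable (X) in
def prQ : X × ℝ →L[ℝ] X × ℝ := (ContinuousLinearMap.inr ℝ X ℝ).comp (ContinuousLinearMap.snd ℝ X ℝ)

lemma sE_deriv {U : Set X} (hU : IsOpen U) {g : X × ℝ → F}
    (hg : ContDiffOn ℝ 1 g (U ×ˢ Iic (0:ℝ))) (h0 : ∀ q : X × ℝ, q.2 < -1 → g q = 0) (l : ℕ)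
    {G : X × ℝ → (X × ℝ →L[ℝ] F)} (hG : ContinuousOn G (U ×ˢ Iic (0:ℝ)))
    (hgG : ∀ q ∈ U ×ˢ Iic (0:ℝ), HasFDerivWithinAt g (G q) (U ×ˢ Iic (0:ℝ)) q)
    (hG0 : ∀ q : X × ℝ, q.2 < -1 → G q = 0)
    (q : X × ℝ) (hq : q.1 ∈ U) :
    HasFDerivAt (sE l g) ((sE l G q).comp (prP X) + (sE (l+1) G q).comp (prQ X)) q := by
  refine glue_deriv (f' := fun q => (sE l G q).comp (prP X) + (sE (l+1) G q).comp (prQ X)) hU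
    (sE_cont hU hg.continuousOn h0 l) ?_ ?_ q hq
  · have h1 := sE_cont hU hG hG0 l
    have h2 := sE_cont hU hG hG0 (l+1)
    exact (h1.clm_comp continuousOn_const).add (h2.clm_comp continuousOn_const)
  clear hq q
  have hgG' : ∀ q : X × ℝ, q.1 ∈ U → q.2 < 0 → HasFDerivAt g (G q) q := by
    intro q hq h
    refine (hgG q ⟨hq, h.le⟩).hasFDerivAt ?_
    refine mem_of_superset ((hU.prod isOpen_Iio).mem_nhds ⟨hq, h⟩) ?_
    exact prod_mono subset_rfl Iio_subset_Iic_self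
  intro q hq hne
  rcases lt_or_gt_of_ne hne with h | h
  · have e1 : (sE l G q).comp (prP X) + (sE (l+1) G q).comp (prQ X) = G q := by
      simp only [sE, h.le, if_true]
      refine ContinuousLinearMap.ext fun z => ?_
      obtain ⟨a, b⟩ := z
      simp [prP, prQ, ← map_add]
    rw [e1]
    refine (hgG' q hq h).congr_of_eventuallyEq ?_
    have : ∀ᶠ y : X × ℝ in 𝓝 q, y.2 < 0 := continuous_snd.continuousAt.eventually_lt continuousAt_const h
    filter_upwards [this] with y hy
    simp [sE, hy.le]
  · obtain ⟨r, hr, hrU, M, hM⟩ := loc_bound hU hG hG0 hq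
    obtain ⟨r', hr', hrU', M', hM'⟩ := loc_bound hU hg.continuousOn h0 hq
    have hM0 : 0 ≤ M := (norm_nonneg _).trans (hM q.1 (Metric.mem_ball_self hr) 0 le_rfl)
    have hs : IsOpen (Metric.ball q.1 r ×ˢ Ioi (0:ℝ)) := Metric.isOpen_ball.prod isOpen_Ioi
    have hqs : q ∈ Metric.ball q.1 r ×ˢ Ioi (0:ℝ) := ⟨Metric.mem_ball_self hr, h⟩
    have hqs' : q ∈ Metric.ball q.1 r' ×ˢ Ici (0:ℝ) := ⟨Metric.mem_ball_self hr', h.le⟩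
    have hqs'' : q ∈ Metric.ball q.1 r ×ˢ Ici (0:ℝ) := ⟨Metric.mem_ball_self hr, h.le⟩
    have hP : ‖prP X‖ ≤ 1 := by
      refine ContinuousLinearMap.opNorm_le_bound _ zero_le_one (fun x => ?_)
      simp [prP, Prod.norm_def]
    have hQ : ‖prQ X‖ ≤ 1 := by
      refine ContinuousLinearMap.opNorm_le_bound _ zero_le_one (fun x => ?_)
      simp [prQ, Prod.norm_def]
    have hsum : ∀ l, HasSum (fun k => (sC k * (-sB k)^l) • G (q.1, -sB k * q.2)) (sE l G q) := by
      intro l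
      simp only [sE, not_le.2 h, if_false]
      exact (Summable.of_norm_bounded ((sC_summable l).mul_right M)
        (fun k => term_bound hM k q hqs'')).hasSum
    have main := hasFDerivAt_tsum_of_isPreconnected
      (f := fun k (q : X × ℝ) => (sC k * (-sB k)^l) • g (q.1, -sB k * q.2))
      (f' := fun k (q : X × ℝ) => ((sC k * (-sB k)^l) • G (q.1, -sB k * q.2)).comp (prP X) +
        ((sC k * (-sB k)^(l+1)) • G (q.1, -sB k * q.2)).comp (prQ X))
      (((sC_summable l).mul_right M).add ((sC_summable (l+1)).mul_right M)) hs
      (((convex_ball _ _).prod (convex_Ioi _)).isPreconnected) ?_ ?_ hqs ?_ hqs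
    · have e : (sE l G q).comp (prP X) + (sE (l+1) G q).comp (prQ X) =
          ∑' k, (((sC k * (-sB k)^l) • G (q.1, -sB k * q.2)).comp (prP X) +
        ((sC k * (-sB k)^(l+1)) • G (q.1, -sB k * q.2)).comp (prQ X)) := by
        have a1 := (hsum l).mapL (((ContinuousLinearMap.compL ℝ (X×ℝ) (X×ℝ) F).flip (prP X)))
        have a2 := (hsum (l+1)).mapL (((ContinuousLinearMap.compL ℝ (X×ℝ) (X×ℝ) F).flip (prQ X)))
        exact (a1.add a2).tsum_eq.symm
      rw [e]
      refine main.congr_of_eventuallyEq ?_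
      filter_upwards [hs.mem_nhds hqs] with y hy
      simp only [sE, not_le.2 (show 0 < y.2 from hy.2), if_false]
    · intro k y hy
      have hB := sB_pos k
      have hy2 : 0 < y.2 := hy.2
      have d1 : HasFDerivAt (fun y : X × ℝ => (y.1, -sB k * y.2)) (prP X + (-sB k) • prQ X) y := by
        have := (prP X + (-sB k) • prQ X).hasFDerivAt (x := y)
        refine this.congr_of_eventuallyEq (Eventually.of_forall fun z => ?_)
        simp [prP, prQ]
      have d2 := (HasFDerivAt.comp y (hgG' (y.1, -sB k * y.2) (hrU hy.1) (by simp; positivity)) d1).const_smul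
        (sC k * (-sB k)^l)
      refine d2.congr_fderiv ?_
      refine ContinuousLinearMap.ext fun z => ?_
      simp [pow_succ, smul_smul, mul_assoc]
    · intro k y hy
      have hy' : y ∈ Metric.ball q.1 r ×ˢ Ici (0:ℝ) := ⟨hy.1, Ioi_subset_Ici_self hy.2⟩
      refine (norm_add_le _ _).trans (add_le_add ?_ ?_)
      · refine (ContinuousLinearMap.opNorm_comp_le _ _).trans ?_
        refine (mul_le_of_le_one_right (norm_nonneg _) hP).trans (term_bound hM k y hy')
      · refine (ContinuousLinearMap.opNorm_comp_le _ _).trans ?_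
        refine (mul_le_of_le_one_right (norm_nonneg _) hQ).trans (term_bound hM k y hy')
    · exact Summable.of_norm_bounded ((sC_summable l).mul_right M')
        (fun k => term_bound hM' k q hqs')
end halfspace

lemma sE_contDiff {X : Type} [NormedAddCommGroup X] [NormedSpace ℝ X] [ProperSpace X]
    {U : Set X} (hU : IsOpen U) (m : ℕ) :
    ∀ {F : Type} [NormedAddCommGroup F] [NormedSpace ℝ F] [CompleteSpace F] (g : X × ℝ → F)
    (_ : ContDiffOn ℝ m g (U ×ˢ Iic (0:ℝ))) (_ : ∀ q : X × ℝ, q.2 < -1 → g q = 0) (l : ℕ),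
    ContDiffOn ℝ m (sE l g) (U ×ˢ univ) := by
  induction m with
  | zero =>
    intro F _ _ _ g hg h0 l
    simp only [Nat.cast_zero, contDiffOn_zero] at *
    exact sE_cont hU hg h0 l
  | succ m ih =>
    intro F _ _ _ g hg h0 l
    have hud : UniqueDiffOn ℝ (U ×ˢ Iic (0:ℝ)) := hU.uniqueDiffOn.prod (uniqueDiffOn_Iic 0)
    classical
    let G : X × ℝ → (X × ℝ →L[ℝ] F) := fun q =>
      if q.2 < -1 then 0 else fderivWithin ℝ g (U ×ˢ Iic (0:ℝ)) q
    have hGe : ∀ q ∈ U ×ˢ Iic (0:ℝ), G q = fderivWithin ℝ g (U ×ˢ Iic (0:ℝ)) q := by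
      intro q hq
      by_cases h : q.2 < -1
      · simp only [G, h, if_true]
        have : g =ᶠ[𝓝 q] fun _ => 0 := by
          filter_upwards [(continuous_snd.continuousAt (x := q)).eventually_lt continuousAt_const h] with y hy
          exact h0 y hy
        rw [this.fderivWithin_eq_of_nhds]
        simp
      · simp only [G, h, if_false]
    have hG0 : ∀ q : X × ℝ, q.2 < -1 → G q = 0 := fun q h => by simp only [G, h, if_true]
    have hg' := (contDiffOn_succ_iff_fderivWithin hud).1 (by exact_mod_cast hg :
      ContDiffOn ℝ ((m : WithTop ℕ∞) + 1) g (U ×ˢ Iic (0:ℝ)))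
    have hGm : ContDiffOn ℝ m G (U ×ˢ Iic (0:ℝ)) := hg'.2.2.congr hGe
    have hd : ∀ q ∈ U ×ˢ (univ : Set ℝ),
        HasFDerivAt (sE l g) ((sE l G q).comp (prP X) + (sE (l+1) G q).comp (prQ X)) q := by
      intro q hq
      refine sE_deriv hU (hg.of_le (by norm_cast; omega)) h0 l hGm.continuousOn ?_ hG0 q hq.1
      intro q hq
      rw [hGe q hq]
      exact (hg'.1 q hq).hasFDerivWithinAt
    have hWo : IsOpen (U ×ˢ (univ : Set ℝ)) := hU.prod isOpen_univ
    push_cast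
    rw [contDiffOn_succ_iff_fderiv_of_isOpen hWo]
    refine ⟨fun q hq => (hd q hq).differentiableAt.differentiableWithinAt, by simp, ?_⟩
    refine ContDiffOn.congr (f := fun q => (sE l G q).comp (prP X) + (sE (l+1) G q).comp (prQ X)) ?_
      (fun q hq => (hd q hq).fderiv)
    exact ((ih G hGm hG0 l).clm_comp contDiffOn_const).add
      ((ih G hGm hG0 (l+1)).clm_comp contDiffOn_const)

lemma ball_ext_unit {n : ℕ} {F : Type} [NormedAddCommGroup F] [NormedSpace ℝ F] [CompleteSpace F]
    (f : Euc n × ℝ → F)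
    (hf : ContDiffOn ℝ (⊤ : ℕ∞) f (Metric.closedBall 0 1 ×ˢ (univ : Set ℝ))) :
    ∃ H : Euc n × ℝ → F, ContDiff ℝ (⊤ : ℕ∞) H ∧
      ∀ x ∈ Metric.closedBall (0 : Euc n) 1, ∀ t, H (x, t) = f (x, t) := by
  classical
  let χ : ℝ → ℝ := fun s => Real.smoothTransition (2 * (s + 1))
  have hχ : ContDiff ℝ (⊤ : ℕ∞) χ := Real.smoothTransition.contDiff.comp (by fun_prop)
  let U : Set (Euc n × ℝ) := {p | p.1 ≠ 0}
  have hU : IsOpen U := isOpen_ne_fun continuous_fst continuous_const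
  let g : (Euc n × ℝ) × ℝ → F := fun q => χ q.2 • f ((Real.exp q.2 / ‖q.1.1‖) • q.1.1, q.1.2)
  have hg0 : ∀ q : (Euc n × ℝ) × ℝ, q.2 < -1 → g q = 0 := by
    intro q hq
    have : χ q.2 = 0 := Real.smoothTransition.zero_of_nonpos (by linarith)
    simp only [g, this, zero_smul]
  have hg : ContDiffOn ℝ (⊤ : ℕ∞) g (U ×ˢ Iic (0:ℝ)) := by
    refine ContDiffOn.smul (hχ.comp contDiff_snd).contDiffOn ?_
    refine hf.comp ?_ ?_
    · intro q hq
      have hq1 : q.1.1 ≠ 0 := hq.1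
      have : ContDiffAt ℝ (⊤ : ℕ∞) (fun q : (Euc n × ℝ) × ℝ => ‖q.1.1‖) q :=
        ContDiffAt.norm ℝ (by fun_prop) hq1
      have h2 : ContDiffAt ℝ (⊤ : ℕ∞) (fun q : (Euc n × ℝ) × ℝ => Real.exp q.2 / ‖q.1.1‖) q :=
        ContDiffAt.div (by fun_prop) this (norm_ne_zero_iff.2 hq1)
      exact ((h2.smul (by fun_prop)).prodMk (by fun_prop)).contDiffWithinAt
    · intro q hq
      have hq1 : q.1.1 ≠ 0 := hq.1
      have hq2 : q.2 ≤ 0 := hq.2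
      refine ⟨?_, trivial⟩
      simp only [mem_closedBall_zero_iff, norm_smul, norm_div, Real.norm_eq_abs, Real.abs_exp,
        abs_norm]
      rw [div_mul_cancel₀ _ (norm_ne_zero_iff.2 hq1)]
      exact Real.exp_le_one_iff.2 hq2
  have hE : ContDiffOn ℝ (⊤ : ℕ∞) (sE 0 g) (U ×ˢ univ) := by
    rw [contDiffOn_infty]
    intro m
    exact sE_contDiff hU m g (hg.of_le (by exact_mod_cast le_top)) hg0 0
  refine ⟨fun q => if ‖q.1‖ ≤ 1 then f q else sE 0 g (q, Real.log ‖q.1‖), ?_, ?_⟩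
  · rw [contDiff_iff_contDiffAt]
    intro q
    by_cases hq : ‖q.1‖ < 1
    · have hn : Metric.ball 0 1 ×ˢ (univ : Set ℝ) ∈ 𝓝 q :=
        (Metric.isOpen_ball.prod isOpen_univ).mem_nhds ⟨by simpa using hq, trivial⟩
      refine (hf.contDiffAt (mem_of_superset hn
        (prod_mono Metric.ball_subset_closedBall subset_rfl))).congr_of_eventuallyEq ?_
      filter_upwards [hn] with y hy
      have : ‖y.1‖ < 1 := by simpa using hy.1
      simp [this.le]
    · have hq1 : Real.exp (-(1/2)) < ‖q.1‖ :=
        (show Real.exp (-(1/2)) < 1 by rw [← Real.exp_zero]; exact Real.exp_lt_exp.2 (by norm_num)).trans_le (not_lt.1 hq)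
      have hq0 : q.1 ≠ 0 := by
        intro h; rw [h, norm_zero] at hq; norm_num at hq
      have h1 : ContDiffAt ℝ (⊤ : ℕ∞) (fun q : Euc n × ℝ => (q, Real.log ‖q.1‖)) q := by
        refine contDiffAt_id.prodMk ?_
        exact (ContDiffAt.norm ℝ (by fun_prop) hq0).log (norm_ne_zero_iff.2 hq0)
      have h2 := ContDiffAt.comp q (hE.contDiffAt ((hU.prod isOpen_univ).mem_nhds
        (⟨hq0, trivial⟩ : (q, Real.log ‖q.1‖) ∈ U ×ˢ univ))) h1
      refine h2.congr_of_eventuallyEq ?_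
      filter_upwards [(isOpen_lt continuous_const (continuous_fst.norm)).mem_nhds hq1] with y hy
      by_cases hy1 : ‖y.1‖ ≤ 1
      · have hy0 : 0 < ‖y.1‖ := (Real.exp_pos _).trans hy
        have hl : Real.log ‖y.1‖ ≤ 0 := Real.log_nonpos hy0.le hy1
        have hl2 : -(1/2) ≤ Real.log ‖y.1‖ := (Real.le_log_iff_exp_le hy0).2 (le_of_lt hy)
        have hχ1 : χ (Real.log ‖y.1‖) = 1 :=
          Real.smoothTransition.one_of_one_le (by linarith)
        simp only [hy1, if_true, Function.comp, sE, hl, g, hχ1, one_smul, Real.exp_log hy0,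
          div_self hy0.ne']
      · simp [hy1]
  · intro x hx t
    simp only [mem_closedBall_zero_iff] at hx
    simp [hx]

lemma ball_ext {n : ℕ} {F : Type} [NormedAddCommGroup F] [NormedSpace ℝ F] [CompleteSpace F]
    (x₀ : Euc n) (r : ℝ) (hr : 0 < r) (f : Euc n × ℝ → F)
    (hf : ContDiffOn ℝ (⊤ : ℕ∞) f (Metric.closedBall x₀ r ×ˢ (univ : Set ℝ))) :
    ∃ H : Euc n × ℝ → F, ContDiff ℝ (⊤ : ℕ∞) H ∧
      ∀ x ∈ Metric.closedBall x₀ r, ∀ t, H (x, t) = f (x, t) := by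
  obtain ⟨H, hH, hHe⟩ := ball_ext_unit (fun q : Euc n × ℝ => f (x₀ + r • q.1, q.2)) (by
    refine hf.comp (by fun_prop) ?_
    rintro q ⟨hq, -⟩
    refine ⟨?_, trivial⟩
    simp only [mem_closedBall_zero_iff] at hq
    simp only [Metric.mem_closedBall, dist_self_add_left, norm_smul, Real.norm_eq_abs, abs_of_pos hr]
    nlinarith)
  refine ⟨fun q => H (r⁻¹ • (q.1 - x₀), q.2), hH.comp (by fun_prop), fun x hx t => ?_⟩
  have := hHe (r⁻¹ • (x - x₀)) (by
    simp only [Metric.mem_closedBall, dist_eq_norm] at hx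
    simp only [mem_closedBall_zero_iff, norm_smul, norm_inv, Real.norm_eq_abs, abs_of_pos hr]
    rw [inv_mul_le_iff₀ hr]; linarith) t
  simp only [this]
  rw [smul_inv_smul₀ hr.ne']
  simp

lemma param_deriv {Y : Type} [NormedAddCommGroup Y] [NormedSpace ℝ Y] [ProperSpace Y]
    {F : Type} [NormedAddCommGroup F] [NormedSpace ℝ F]
    (K : Y × ℝ → F) (hK : ContDiff ℝ 1 K) (y : Y) :
    HasFDerivAt (fun y => ∫ r in (0:ℝ)..1, K (y, r))
      (∫ r in (0:ℝ)..1, (fderiv ℝ K (y, r)).comp (ContinuousLinearMap.inl ℝ Y ℝ)) y := by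
  have hK' : Continuous (fderiv ℝ K) := hK.continuous_fderiv (by norm_num)
  have hKc := hK.continuous
  have hcomp : Continuous (fun q : Y × ℝ => (fderiv ℝ K q).comp (ContinuousLinearMap.inl ℝ Y ℝ)) :=
    hK'.clm_comp continuous_const
  obtain ⟨M, hM⟩ := ((isCompact_closedBall y 1).prod (isCompact_Icc (a := (0:ℝ)) (b := 1))).exists_bound_of_continuousOn hcomp.continuousOn
  refine intervalIntegral.hasFDerivAt_integral_of_dominated_of_fderiv_le
    (F' := fun y r => (fderiv ℝ K (y, r)).comp (ContinuousLinearMap.inl ℝ Y ℝ))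
    (bound := fun _ => M) (Metric.closedBall_mem_nhds y one_pos) ?_ ?_ ?_ ?_ ?_ ?_
  · exact Eventually.of_forall fun z => (by fun_prop : Continuous fun r => K (z, r)).aestronglyMeasurable
  · exact (by fun_prop : Continuous fun r => K (y, r)).intervalIntegrable _ _
  · exact (hcomp.comp (by fun_prop : Continuous fun r : ℝ => (y, r))).aestronglyMeasurable
  · refine Eventually.of_forall fun t ht z hz => hM (z, t) ⟨hz, ?_⟩
    rw [uIoc_of_le zero_le_one] at ht
    exact ⟨ht.1.le, ht.2⟩
  · exact intervalIntegrable_const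
  · refine Eventually.of_forall fun t ht z hz => ?_
    have h1 := (hK.differentiable (by norm_num) (z, t)).hasFDerivAt
    have h2 : HasFDerivAt (fun z : Y => (z, t)) (ContinuousLinearMap.inl ℝ Y ℝ) z :=
      hasFDerivAt_prodMk_left z t
    exact h1.comp z h2

lemma param_contDiff {Y : Type} [NormedAddCommGroup Y] [NormedSpace ℝ Y] [ProperSpace Y] (m : ℕ) :
    ∀ {F : Type} [NormedAddCommGroup F] [NormedSpace ℝ F]
    (K : Y × ℝ → F) (_ : ContDiff ℝ m K), ContDiff ℝ m (fun y => ∫ r in (0:ℝ)..1, K (y, r)) := by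
  induction m with
  | zero =>
    intro F _ _ K hK
    simp only [Nat.cast_zero, contDiff_zero] at *
    exact intervalIntegral.continuous_parametric_intervalIntegral_of_continuous' (f := fun y r => K (y, r)) (by exact hK) 0 1
  | succ m ih =>
    intro F _ _ K hK
    have hd := param_deriv K (hK.of_le (by norm_cast; omega))
    have hK1 : ContDiff ℝ ((m : WithTop ℕ∞) + 1) K := by exact_mod_cast hK
    push_cast
    rw [contDiff_succ_iff_fderiv]
    refine ⟨fun y => (hd y).differentiableAt, by simp, ?_⟩
    have : fderiv ℝ (fun y => ∫ r in (0:ℝ)..1, K (y, r)) = fun y =>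
      ∫ r in (0:ℝ)..1, (fderiv ℝ K (y, r)).comp (ContinuousLinearMap.inl ℝ Y ℝ) :=
      funext fun y => (hd y).fderiv
    rw [this]
    refine ih (fun q => (fderiv ℝ K q).comp (ContinuousLinearMap.inl ℝ Y ℝ)) ?_
    exact ((contDiff_succ_iff_fderiv.1 hK1).2.2).clm_comp contDiff_const

section calculus
variable {n : ℕ} {f g : Euc n × ℝ → ℝ}

lemma spd_eq (j : Fin n) (q : Euc n × ℝ) (hf : DifferentiableAt ℝ f q) :
    spd j f q = fderiv ℝ f q (EuclideanSpace.single j 1, 0) := by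
  have h2 : HasFDerivAt (fun z : Euc n => (z, q.2)) (ContinuousLinearMap.inl ℝ (Euc n) ℝ) q.1 :=
    hasFDerivAt_prodMk_left q.1 q.2
  have := (hf.hasFDerivAt (x := (q.1, q.2))).comp q.1 h2
  unfold spd
  rw [show (fun y => f (y, q.2)) = f ∘ (fun z => (z, q.2)) from rfl, this.fderiv]
  simp

lemma tpd_eq (q : Euc n × ℝ) (hf : DifferentiableAt ℝ f q) :
    tpd f q = fderiv ℝ f q (0, 1) := by
  have h2 : HasFDerivAt (fun z : ℝ => (q.1, z)) (ContinuousLinearMap.inr ℝ (Euc n) ℝ) q.2 :=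
    hasFDerivAt_prodMk_right q.1 q.2
  have := (hf.hasFDerivAt (x := (q.1, q.2))).comp q.2 h2
  unfold tpd
  rw [show (fun y => f (q.1, y)) = f ∘ (fun z => (q.1, z)) from rfl, this.hasDerivAt.deriv]
  simp

lemma sm_diff (hf : ContDiff ℝ (⊤ : ℕ∞) f) (q : Euc n × ℝ) : DifferentiableAt ℝ f q :=
  hf.differentiable (by simp) q

lemma spd_eq' (j : Fin n) (hf : ContDiff ℝ (⊤ : ℕ∞) f) :
    spd j f = fun q => fderiv ℝ f q (EuclideanSpace.single j 1, 0) :=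
  funext fun q => spd_eq j q (sm_diff hf q)

lemma sm_fderiv (hf : ContDiff ℝ (⊤ : ℕ∞) f) (z : Euc n × ℝ) :
    ContDiff ℝ (⊤ : ℕ∞) (fun q => fderiv ℝ f q z) :=
  (hf.fderiv_right (m := (⊤ : ℕ∞)) (by simp)).clm_apply contDiff_const

lemma sm_spd (j : Fin n) (hf : ContDiff ℝ (⊤ : ℕ∞) f) : ContDiff ℝ (⊤ : ℕ∞) (spd j f) := by
  rw [spd_eq' j hf]; exact sm_fderiv hf _

lemma sm_tpd (hf : ContDiff ℝ (⊤ : ℕ∞) f) : ContDiff ℝ (⊤ : ℕ∞) (tpd f) := by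
  rw [show tpd f = fun q => fderiv ℝ f q (0, 1) from funext fun q => tpd_eq q (sm_diff hf q)]
  exact sm_fderiv hf _

lemma spd_add (j : Fin n) (hf : ContDiff ℝ (⊤ : ℕ∞) f) (hg : ContDiff ℝ (⊤ : ℕ∞) g) (q) :
    spd j (fun q => f q + g q) q = spd j f q + spd j g q := by
  rw [spd_eq j q (sm_diff (hf.add hg) q), spd_eq j q (sm_diff hf q), spd_eq j q (sm_diff hg q),
    fderiv_fun_add (sm_diff hf q) (sm_diff hg q)]
  rfl

lemma spd_sub (j : Fin n) (hf : ContDiff ℝ (⊤ : ℕ∞) f) (hg : ContDiff ℝ (⊤ : ℕ∞) g) (q) :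
    spd j (fun q => f q - g q) q = spd j f q - spd j g q := by
  rw [spd_eq j q (sm_diff (hf.sub hg) q), spd_eq j q (sm_diff hf q), spd_eq j q (sm_diff hg q),
    fderiv_fun_sub (sm_diff hf q) (sm_diff hg q)]
  rfl

lemma spd_cmul (j : Fin n) (c : ℝ) (hf : ContDiff ℝ (⊤ : ℕ∞) f) (q) :
    spd j (fun q => c * f q) q = c * spd j f q := by
  rw [spd_eq j q (sm_diff (contDiff_const.mul hf) q), spd_eq j q (sm_diff hf q),
    fderiv_const_mul (sm_diff hf q)]
  rfl

lemma spd_sum (j : Fin n) {ι : Type} (s : Finset ι) {f : ι → Euc n × ℝ → ℝ}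
    (hf : ∀ i, ContDiff ℝ (⊤ : ℕ∞) (f i)) (q) :
    spd j (fun q => ∑ i ∈ s, f i q) q = ∑ i ∈ s, spd j (f i) q := by
  rw [spd_eq j q (sm_diff (ContDiff.sum fun i _ => hf i) q), fderiv_fun_sum (fun i _ => sm_diff (hf i) q)]
  simp only [sum_apply]
  exact Finset.sum_congr rfl fun i _ => (spd_eq j q (sm_diff (hf i) q)).symm

lemma spd_zero (j : Fin n) (q) : spd j (fun _ => (0:ℝ)) q = 0 := by simp [spd]

lemma spd_comm (i j : Fin n) (hf : ContDiff ℝ (⊤ : ℕ∞) f) (q) :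
    spd i (spd j f) q = spd j (spd i f) q := by
  have h1 : DifferentiableAt ℝ (fderiv ℝ f) q :=
    (hf.fderiv_right (m := (⊤ : ℕ∞)) (by simp)).differentiable (by simp) q
  have e : ∀ i j : Fin n, spd i (spd j f) q = fderiv ℝ (fderiv ℝ f) q (EuclideanSpace.single i 1, 0)
      (EuclideanSpace.single j 1, 0) := by
    intro i j
    rw [spd_eq i q (sm_diff (sm_spd j hf) q), spd_eq' j hf, fderiv_clm_apply h1 (by simp)]
    simp
  rw [e, e]
  have := hf.contDiffAt.isSymmSndFDerivAt (x := q) (by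
    simp only [minSmoothness_of_isRCLikeNormedField]
    exact (by exact_mod_cast le_top : (((2 : ℕ) : ℕ∞) : WithTop ℕ∞) ≤ ((⊤ : ℕ∞) : WithTop ℕ∞)))
  exact this _ _

lemma spd_congr_ball {x₀ : Euc n} {r : ℝ}
    (h : ∀ q ∈ Metric.closedBall x₀ r ×ˢ (univ : Set ℝ), f q = g q) (j : Fin n)
    (q : Euc n × ℝ) (hq : q ∈ Metric.ball x₀ r ×ˢ (univ : Set ℝ)) : spd j f q = spd j g q := by
  unfold spd
  have : (fun y => f (y, q.2)) =ᶠ[𝓝 q.1] (fun y => g (y, q.2)) := by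
    filter_upwards [Metric.isOpen_ball.mem_nhds hq.1] with y hy
    exact h (y, q.2) ⟨Metric.ball_subset_closedBall hy, trivial⟩
  rw [this.fderiv_eq]

lemma tpd_congr_ball {x₀ : Euc n} {r : ℝ}
    (h : ∀ q ∈ Metric.closedBall x₀ r ×ˢ (univ : Set ℝ), f q = g q)
    (q : Euc n × ℝ) (hq : q ∈ Metric.ball x₀ r ×ˢ (univ : Set ℝ)) : tpd f q = tpd g q := by
  unfold tpd
  congr 1
  funext s
  exact h (q.1, s) ⟨Metric.ball_subset_closedBall hq.1, trivial⟩

lemma zero_closed {x₀ : Euc n} {r : ℝ} (hr : 0 < r) (hf : Continuous f)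
    (h : ∀ q ∈ Metric.ball x₀ r ×ˢ (univ : Set ℝ), f q = 0) :
    ∀ q ∈ Metric.closedBall x₀ r ×ˢ (univ : Set ℝ), f q = 0 := by
  intro q hq
  have : q ∈ closure (Metric.ball x₀ r ×ˢ (univ : Set ℝ)) := by
    rw [closure_prod_eq, closure_ball _ hr.ne', closure_univ]; exact hq
  exact closure_minimal (t := {q | f q = 0}) h (isClosed_eq hf continuous_const) this

lemma spd_zero_ball {x₀ : Euc n} {r : ℝ} (hr : 0 < r) (hf : ContDiff ℝ (⊤ : ℕ∞) f)
    (h : ∀ q ∈ Metric.closedBall x₀ r ×ˢ (univ : Set ℝ), f q = 0) (j : Fin n) :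
    ∀ q ∈ Metric.closedBall x₀ r ×ˢ (univ : Set ℝ), spd j f q = 0 := by
  refine zero_closed hr (sm_spd j hf).continuous fun q hq => ?_
  rw [spd_congr_ball (g := fun _ => 0) h j q hq, spd_zero]

end calculus

lemma div_solve {n : ℕ} (hn : 1 ≤ n) (x₀ : Euc n) (rad : ℝ) (h : Euc n × ℝ → ℝ)
    (hh : ContDiff ℝ (⊤ : ℕ∞) h)
    (h0 : ∀ q ∈ Metric.closedBall x₀ rad ×ˢ (univ : Set ℝ), h q = 0) :
    ∃ w : Fin n → Euc n × ℝ → ℝ, (∀ i, ContDiff ℝ (⊤ : ℕ∞) (w i)) ∧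
      (∀ i, ∀ q ∈ Metric.closedBall x₀ rad ×ˢ (univ : Set ℝ), w i q = 0) ∧
      ∀ q, ∑ i, spd i (w i) q = h q := by
  let I : Euc n × ℝ → ℝ := fun q => ∫ r in (0:ℝ)..1, r ^ (n-1) * h (x₀ + r • (q.1 - x₀), q.2)
  have hI : ContDiff ℝ (⊤ : ℕ∞) I := by
    rw [contDiff_infty]
    intro m
    refine param_contDiff m (fun p : (Euc n × ℝ) × ℝ => p.2 ^ (n-1) * h (x₀ + p.2 • (p.1.1 - x₀), p.1.2)) ?_
    refine ContDiff.of_le ?_ (show (m : WithTop ℕ∞) ≤ ((⊤ : ℕ∞) : WithTop ℕ∞) by exact_mod_cast le_top)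
    exact (by fun_prop : ContDiff ℝ (⊤ : ℕ∞) (fun p : (Euc n × ℝ) × ℝ => p.2 ^ (n-1))).mul
      (hh.comp (by fun_prop))
  have hc : ∀ i, ContDiff ℝ (⊤ : ℕ∞) (fun q : Euc n × ℝ => q.1 i - x₀ i) := by
    intro i; fun_prop
  refine ⟨fun i q => (q.1 i - x₀ i) * I q, fun i => (hc i).mul hI, ?_, ?_⟩
  · intro i q hq
    have : I q = 0 := by
      have e : ∀ r ∈ uIcc (0:ℝ) 1, r ^ (n-1) * h (x₀ + r • (q.1 - x₀), q.2) = 0 := by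
        intro r hr
        rw [uIcc_of_le zero_le_one] at hr
        rw [h0, mul_zero]
        refine ⟨?_, trivial⟩
        have h1 := hq.1
        simp only [Metric.mem_closedBall, dist_eq_norm, add_sub_cancel_left, norm_smul, Real.norm_eq_abs,
          abs_of_nonneg hr.1] at h1 ⊢
        nlinarith [norm_nonneg (q.1 - x₀), hr.1, hr.2]
      simp only [I]
      rw [intervalIntegral.integral_congr e]; simp
    simp [this]
  · intro q
    have e1 : ∀ i, spd i (fun q : Euc n × ℝ => (q.1 i - x₀ i) * I q) q =
        I q + (q.1 i - x₀ i) * fderiv ℝ I q (EuclideanSpace.single i 1, 0) := by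
      intro i
      rw [spd_eq i q (sm_diff ((hc i).mul hI) q), fderiv_fun_mul (sm_diff (hc i) q) (sm_diff hI q)]
      have : HasFDerivAt (fun q : Euc n × ℝ => q.1 i - x₀ i)
          ((EuclideanSpace.proj i).comp (ContinuousLinearMap.fst ℝ (Euc n) ℝ)) q :=
        (((EuclideanSpace.proj i : Euc n →L[ℝ] ℝ).comp (ContinuousLinearMap.fst ℝ (Euc n) ℝ)).hasFDerivAt).sub_const _
      rw [this.fderiv]
      simp
      ring
    simp_rw [e1]
    rw [Finset.sum_add_distrib]
    have e2 : ∑ i, (q.1 i - x₀ i) * fderiv ℝ I q (EuclideanSpace.single i 1, 0) =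
        fderiv ℝ I q (q.1 - x₀, 0) := by
      have : ((q.1 - x₀, 0) : Euc n × ℝ) = ∑ i, (q.1 i - x₀ i) • ((EuclideanSpace.single i 1, 0) : Euc n × ℝ) := by
        ext j
        · simp [Prod.fst_sum, Pi.single_apply]
        · simp [Prod.snd_sum]
      rw [this, map_sum]
      simp only [map_smul, smul_eq_mul]
    rw [e2]
    simp only [Finset.sum_const, Finset.card_univ, Fintype.card_fin, nsmul_eq_mul]
    -- homogeneity
    set z := q.1 - x₀ with hz
    have hcurve : HasDerivAt (fun l : ℝ => ((x₀ + l • z, q.2) : Euc n × ℝ)) (z, 0) 1 := by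
      refine HasDerivAt.prodMk ?_ (hasDerivAt_const _ _)
      simpa using ((hasDerivAt_id (1:ℝ)).smul_const z).const_add x₀
    have hq1 : ((x₀ + (1:ℝ) • z, q.2) : Euc n × ℝ) = q := by simp [hz]
    have d1 : HasDerivAt (fun l : ℝ => l ^ n * I (x₀ + l • z, q.2)) (n * I q + fderiv ℝ I q (z, 0)) 1 := by
      have a := (sm_diff hI (x₀ + (1:ℝ) • z, q.2)).hasFDerivAt.comp_hasDerivAt (1:ℝ) hcurve
      have a2 : HasDerivAt (fun l : ℝ => l ^ n * I (x₀ + l • z, q.2)) _ 1 :=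
        (hasDerivAt_pow n (1:ℝ)).mul a
      refine a2.congr_deriv ?_
      simp only [hq1]
      simp
    have e3 : (fun l : ℝ => l ^ n * I (x₀ + l • z, q.2)) =
        fun l => ∫ s in (0:ℝ)..l, s^(n-1) * h (x₀ + s • z, q.2) := by
      funext l
      have := intervalIntegral.mul_integral_comp_mul_left (a := 0) (b := 1)
        (f := fun s => s^(n-1) * h (x₀ + s • z, q.2)) l
      simp only [mul_zero, mul_one] at this
      rw [← this]
      obtain ⟨m, rfl⟩ : ∃ m, n = m + 1 := ⟨n - 1, by omega⟩
      simp only [I, add_tsub_cancel_right, pow_succ', mul_assoc]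
      congr 1
      rw [← intervalIntegral.integral_const_mul]
      congr 1
      funext r
      rw [mul_pow, mul_assoc]
      congr 4
      simp [smul_smul, mul_comm]
    have hcont : Continuous (fun s : ℝ => s^(n-1) * h (x₀ + s • z, q.2)) := by
      have := hh.continuous
      fun_prop
    have d2 : HasDerivAt (fun l : ℝ => ∫ s in (0:ℝ)..l, s^(n-1) * h (x₀ + s • z, q.2))
        ((1:ℝ)^(n-1) * h (x₀ + (1:ℝ) • z, q.2)) 1 :=
      hcont.integral_hasStrictDerivAt 0 1 |>.hasDerivAt
    rw [e3] at d1
    have := d1.unique d2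
    rw [this, hq1]; simp

lemma sym_solve {n : ℕ} (hn : 1 ≤ n) (x₀ : Euc n) (rad : ℝ) (hrad : 0 < rad)
    (g : Fin n → Euc n × ℝ → ℝ) (hg : ∀ i, ContDiff ℝ (⊤ : ℕ∞) (g i))
    (h0 : ∀ i, ∀ q ∈ Metric.closedBall x₀ rad ×ˢ (univ : Set ℝ), g i q = 0) :
    ∃ S : Fin n → Fin n → Euc n × ℝ → ℝ, (∀ i j, ContDiff ℝ (⊤ : ℕ∞) (S i j)) ∧
      (∀ i j, ∀ q ∈ Metric.closedBall x₀ rad ×ˢ (univ : Set ℝ), S i j q = 0) ∧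
      (∀ i j q, S i j q = S j i q) ∧
      ∀ i q, ∑ j, spd j (S i j) q = g i q := by
  choose T hT hT0 hTd using fun i => div_solve hn x₀ rad (g i) (hg i) (h0 i)
  choose w hw hw0 hwd using fun i j => div_solve hn x₀ rad (T i j) (hT i j) (hT0 i j)
  -- antisymmetric in the first two indices, with divergence `T j i - T i j`
  let D : Fin n → Fin n → Fin n → Euc n × ℝ → ℝ := fun i j k q => w j i k q - w i j k q
  have hD : ∀ i j k, ContDiff ℝ (⊤ : ℕ∞) (D i j k) := fun i j k => (hw j i k).sub (hw i j k)
  have hDa : ∀ i j k q, D i j k q = - D j i k q := fun i j k q => by simp only [D]; ring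
  have hDd : ∀ i j q, ∑ k, spd k (D i j k) q = T j i q - T i j q := by
    intro i j q
    simp only [D]
    simp_rw [fun k => spd_sub k (hw j i k) (hw i j k) q]
    rw [Finset.sum_sub_distrib, hwd, hwd]
  have hD0 : ∀ i j k, ∀ q ∈ Metric.closedBall x₀ rad ×ˢ (univ : Set ℝ), D i j k q = 0 := by
    intro i j k q hq
    simp only [D, hw0 _ _ _ q hq, sub_self]
  -- antisymmetric in the last two indices
  let C : Fin n → Fin n → Fin n → Euc n × ℝ → ℝ := fun i j k q =>
    (1/2) * (D i j k q - D j k i q + D k i j q)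
  have hC : ∀ i j k, ContDiff ℝ (⊤ : ℕ∞) (C i j k) := fun i j k =>
    contDiff_const.mul (((hD i j k).sub (hD j k i)).add (hD k i j))
  have hC0 : ∀ i j k, ∀ q ∈ Metric.closedBall x₀ rad ×ˢ (univ : Set ℝ), C i j k q = 0 := by
    intro i j k q hq
    simp only [C, hD0 _ _ _ q hq]; ring
  have hCa : ∀ i j k, C i j k = fun q => (-1) * C i k j q := by
    intro i j k; funext q
    simp only [C]
    rw [hDa i k j, hDa k j i, hDa j i k]; ring
  have hCD : ∀ i j k, D i j k = fun q => C i j k q - C j i k q := by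
    intro i j k; funext q
    simp only [C]
    rw [hDa j i k, hDa i k j, hDa k j i]; ring
  refine ⟨fun i j q => T i j q + ∑ k, spd k (C i j k) q, ?_, ?_, ?_, ?_⟩
  · intro i j
    exact (hT i j).add (ContDiff.sum fun k _ => sm_spd k (hC i j k))
  · intro i j q hq
    change T i j q + ∑ k, spd k (C i j k) q = 0
    rw [hT0 i j q hq, Finset.sum_eq_zero fun k _ => spd_zero_ball hrad (hC i j k) (hC0 i j k) k q hq]
    simp
  · intro i j q
    change T i j q + ∑ k, spd k (C i j k) q = T j i q + ∑ k, spd k (C j i k) q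
    have := hDd i j q
    simp_rw [fun k => hCD i j k, fun k => spd_sub k (hC i j k) (hC j i k) q] at this
    rw [Finset.sum_sub_distrib] at this
    linarith
  · intro i q
    have e : ∀ j, spd j (fun q => T i j q + ∑ k, spd k (C i j k) q) q
        = spd j (T i j) q + ∑ k, spd j (spd k (C i j k)) q := by
      intro j
      rw [spd_add j (hT i j) (ContDiff.sum fun k _ => sm_spd k (hC i j k)),
        spd_sum j Finset.univ (fun k => sm_spd k (hC i j k))]
    simp_rw [e]
    rw [Finset.sum_add_distrib, hTd]
    have e2 : ∑ j, ∑ k, spd j (spd k (C i j k)) q = - ∑ j, ∑ k, spd j (spd k (C i j k)) q := by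
      conv_lhs => rw [Finset.sum_comm]
      rw [← Finset.sum_neg_distrib]
      refine Finset.sum_congr rfl fun j _ => ?_
      rw [← Finset.sum_neg_distrib]
      refine Finset.sum_congr rfl fun k _ => ?_
      rw [spd_comm k j (hC i k j), hCa i k j]
      rw [show spd k (fun q => -1 * C i j k q) = fun q => -1 * spd k (C i j k) q from
        funext fun q => spd_cmul k (-1) (hC i j k) q, spd_cmul j (-1) (sm_spd k (hC i j k))]
      ring
    linarith

/-- A subsolution defined on a closed ball `B = closedBall x₀ rad`
(smooth up to the boundary, satisfying the equations on the open ball) extends to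
a smooth subsolution on all of `ℝⁿ × ℝ` agreeing with it on `B`. -/
theorem extension_of_subsolutions_from_ball
    (n : ℕ) (hn : 2 ≤ n) (x₀ : Euc n) (rad : ℝ) (hrad : 0 < rad)
    (v₀ : Euc n × ℝ → Fin n → ℝ) (p₀ : Euc n × ℝ → ℝ)
    (R₀ : Euc n × ℝ → Fin n → Fin n → ℝ)
    (hv₀ : ContDiffOn ℝ (⊤ : ℕ∞) v₀ (Metric.closedBall x₀ rad ×ˢ (Set.univ : Set ℝ)))
    (hp₀ : ContDiffOn ℝ (⊤ : ℕ∞) p₀ (Metric.closedBall x₀ rad ×ˢ (Set.univ : Set ℝ)))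
    (hR₀ : ContDiffOn ℝ (⊤ : ℕ∞) R₀ (Metric.closedBall x₀ rad ×ˢ (Set.univ : Set ℝ)))
    (hsym : ∀ q ∈ Metric.closedBall x₀ rad ×ˢ (Set.univ : Set ℝ),
      ∀ i j, R₀ q i j = R₀ q j i)
    (htr : ∀ q ∈ Metric.closedBall x₀ rad ×ˢ (Set.univ : Set ℝ), ∑ i, R₀ q i i = 0)
    (heuler : ∀ q ∈ Metric.ball x₀ rad ×ˢ (Set.univ : Set ℝ), ∀ i,
      tpd (fun y => v₀ y i) q + (∑ j, v₀ q j * spd j (fun y => v₀ y i) q)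
        + spd i p₀ q = ∑ j, spd j (fun y => R₀ y i j) q)
    (hdiv : ∀ q ∈ Metric.ball x₀ rad ×ˢ (Set.univ : Set ℝ),
      ∑ i, spd i (fun y => v₀ y i) q = 0) :
    ∃ (v : Euc n × ℝ → Fin n → ℝ) (p : Euc n × ℝ → ℝ)
      (R : Euc n × ℝ → Fin n → Fin n → ℝ),
      IsSubsolutionOn (Set.univ : Set (Euc n × ℝ)) v p R ∧
      ∀ x ∈ Metric.closedBall x₀ rad, ∀ t : ℝ,
        v (x, t) = v₀ (x, t) ∧ p (x, t) = p₀ (x, t) ∧ R (x, t) = R₀ (x, t) := by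
  have hn1 : 1 ≤ n := by omega
  have hn0 : (n : ℝ) ≠ 0 := by positivity
  obtain ⟨v₁, hv₁, hv₁e⟩ := ball_ext x₀ rad hrad v₀ hv₀
  obtain ⟨p₁, hp₁, hp₁e⟩ := ball_ext x₀ rad hrad p₀ hp₀
  obtain ⟨R₁, hR₁, hR₁e⟩ := ball_ext x₀ rad hrad R₀ hR₀
  have hv₁c : ∀ i, ContDiff ℝ (⊤ : ℕ∞) (fun q => v₁ q i) := fun i => contDiff_pi.1 hv₁ i
  have hR₁c : ∀ i j, ContDiff ℝ (⊤ : ℕ∞) (fun q => R₁ q i j) := fun i j =>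
    contDiff_pi.1 (contDiff_pi.1 hR₁ i) j
  have hv₁e' : ∀ i, ∀ q ∈ Metric.closedBall x₀ rad ×ˢ (univ : Set ℝ), v₁ q i = v₀ q i :=
    fun i q hq => congrFun (hv₁e q.1 hq.1 q.2) i
  -- make the velocity divergence free
  obtain ⟨w, hw, hw0, hwd⟩ := div_solve hn1 x₀ rad (fun q => ∑ i, spd i (fun y => v₁ y i) q)
    (ContDiff.sum fun i _ => sm_spd i (hv₁c i))
    (zero_closed hrad (ContDiff.sum fun i _ => sm_spd i (hv₁c i)).continuous (by
      intro q hq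
      rw [← hdiv q hq]
      exact Finset.sum_congr rfl fun i _ => spd_congr_ball (hv₁e' i) i q hq))
  let v : Euc n × ℝ → Fin n → ℝ := fun q i => v₁ q i - w i q
  have hvc : ∀ i, ContDiff ℝ (⊤ : ℕ∞) (fun q => v q i) := fun i => (hv₁c i).sub (hw i)
  have hve : ∀ i, ∀ q ∈ Metric.closedBall x₀ rad ×ˢ (univ : Set ℝ), v q i = v₀ q i := by
    intro i q hq
    simp only [v, hw0 i q hq, hv₁e' i q hq, sub_zero]
  let R₂ : Fin n → Fin n → Euc n × ℝ → ℝ := fun i j q => (1/2) * (R₁ q i j + R₁ q j i)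
  have hR₂c : ∀ i j, ContDiff ℝ (⊤ : ℕ∞) (R₂ i j) := fun i j =>
    contDiff_const.mul ((hR₁c i j).add (hR₁c j i))
  have hR₂e : ∀ i j, ∀ q ∈ Metric.closedBall x₀ rad ×ˢ (univ : Set ℝ), R₂ i j q = R₀ q i j := by
    intro i j q hq
    have e : R₁ q = R₀ q := hR₁e q.1 hq.1 q.2
    simp only [R₂, e]
    rw [hsym q hq j i]; ring
  have hp₁e' : ∀ q ∈ Metric.closedBall x₀ rad ×ˢ (univ : Set ℝ), p₁ q = p₀ q :=
    fun q hq => hp₁e q.1 hq.1 q.2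
  let g : Fin n → Euc n × ℝ → ℝ := fun i q => tpd (fun y => v y i) q
      + (∑ j, v q j * spd j (fun y => v y i) q) + spd i p₁ q - ∑ j, spd j (R₂ i j) q
  have hgc : ∀ i, ContDiff ℝ (⊤ : ℕ∞) (g i) := by
    intro i
    exact (((sm_tpd (hvc i)).add (ContDiff.sum fun j _ => (hvc j).mul (sm_spd j (hvc i)))).add
      (sm_spd i hp₁)).sub (ContDiff.sum fun j _ => sm_spd j (hR₂c i j))
  have hg0 : ∀ i, ∀ q ∈ Metric.closedBall x₀ rad ×ˢ (univ : Set ℝ), g i q = 0 := by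
    intro i
    refine zero_closed hrad (hgc i).continuous fun q hq => ?_
    have hq' : q ∈ Metric.closedBall x₀ rad ×ˢ (univ : Set ℝ) :=
      ⟨Metric.ball_subset_closedBall hq.1, trivial⟩
    have := heuler q hq i
    simp only [g]
    rw [tpd_congr_ball (hve i) q hq, spd_congr_ball hp₁e' i q hq, sub_eq_zero]
    simp_rw [fun j => spd_congr_ball (hve i) j q hq, fun j => hve j q hq',
      fun j => spd_congr_ball (hR₂e i j) j q hq]
    exact this
  obtain ⟨S, hS, hS0, hSs, hSd⟩ := sym_solve hn1 x₀ rad hrad g hgc hg0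
  -- the trace is moved into the pressure
  let τ : Euc n × ℝ → ℝ := fun q => (1 / (n:ℝ)) * ∑ i, (R₂ i i q + S i i q)
  have hτ : ContDiff ℝ (⊤ : ℕ∞) τ :=
    contDiff_const.mul (ContDiff.sum fun i _ => (hR₂c i i).add (hS i i))
  have hτ0 : ∀ q ∈ Metric.closedBall x₀ rad ×ˢ (univ : Set ℝ), τ q = 0 := by
    intro q hq
    simp only [τ]
    simp_rw [fun i => hR₂e i i q hq, fun i => hS0 i i q hq, add_zero]
    rw [htr q hq, mul_zero]
  let δ : Fin n → Fin n → ℝ := fun i j => if i = j then 1 else 0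
  have hRc : ∀ i j, ContDiff ℝ (⊤ : ℕ∞) (fun q => R₂ i j q + S i j q - δ i j * τ q) := fun i j =>
    ((hR₂c i j).add (hS i j)).sub (contDiff_const.mul hτ)
  refine ⟨v, fun q => p₁ q - τ q, fun q i j => R₂ i j q + S i j q - δ i j * τ q,
    ⟨?_, ?_, ?_, ?_, ?_, ?_, ?_⟩, ?_⟩
  · exact (contDiff_pi.2 hvc).contDiffOn
  · exact (hp₁.sub hτ).contDiffOn
  · exact (contDiff_pi.2 fun i => contDiff_pi.2 fun j => hRc i j).contDiffOn
  · intro q _ i j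
    have : δ i j = δ j i := by simp only [δ, eq_comm]
    simp only [R₂, hSs i j q, this]; ring
  · intro q _
    rw [Finset.sum_sub_distrib]
    simp only [δ, if_true, one_mul, Finset.sum_const, Finset.card_univ, Fintype.card_fin,
      nsmul_eq_mul, τ]
    field_simp
    ring
  · intro q _ i
    have e : ∀ j, spd j (fun q => R₂ i j q + S i j q - δ i j * τ q) q =
        spd j (R₂ i j) q + spd j (S i j) q - δ i j * spd j τ q := by
      intro j
      rw [spd_sub j ((hR₂c i j).add (hS i j)) (contDiff_const.mul hτ),
        spd_add j (hR₂c i j) (hS i j), spd_cmul j _ hτ]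
    simp_rw [e]
    rw [Finset.sum_sub_distrib, Finset.sum_add_distrib, hSd, spd_sub i hp₁ hτ]
    simp only [δ, g, ite_mul, one_mul, zero_mul, Finset.sum_ite_eq, Finset.mem_univ, if_true]
    ring
  · intro q _
    simp only [v]
    simp_rw [fun i => spd_sub i (hv₁c i) (hw i) q]
    rw [Finset.sum_sub_distrib, hwd, sub_self]
  · intro x hx t
    have hq : (x, t) ∈ Metric.closedBall x₀ rad ×ˢ (univ : Set ℝ) := ⟨hx, trivial⟩
    refine ⟨funext fun i => hve i _ hq, ?_, ?_⟩
    · simp only [hp₁e' _ hq, hτ0 _ hq, sub_zero]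
    · funext i j
      simp only [hR₂e i j _ hq, hS0 i j _ hq, hτ0 _ hq]
      ring
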